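/- arXiv:math/0512395 — 3 statements merged into one kernel-verified Lean document; each statement's English description precedes it below -/
import Mathlib

section
/- Let φ : ℝ² → ℝ be a smooth compactly supported function with ∫_{ℝ²} φ(y) dy = 0, and let f(x) = −(1/2π)∫_{ℝ²} log‖x−y‖ φ(y) dy be its logarithmic potential. Then there exist constants C > 0 and R₀ > 0 such that ‖∇f(x)‖ ≤ C/‖x‖² for all x with ‖x‖ ≥ R₀. -/
open MeasureTheory

theorem hasFDerivAt_log_norm {E : Type*} [NormedAddCommGroup E] [InnerProductSpace ℝ E]
    {z : E} (hz : z ≠ 0) :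
    HasFDerivAt (fun z : E => Real.log ‖z‖) (innerSL ℝ ((1 / ‖z‖) ^ 2 • z)) z := by
  have hz' : ‖z‖ ^ 2 ≠ 0 := by simpa using hz
  have h := (((hasStrictFDerivAt_norm_sq z).hasFDerivAt).log hz').const_mul (1 / 2 : ℝ)
  have hfun : (fun z : E => Real.log ‖z‖) = fun z => 1 / 2 * Real.log (‖z‖ ^ 2) := by
    funext w
    rw [Real.log_pow]
    push_cast
    ring
  rw [hfun]
  refine h.congr_fderiv ?_
  ext w
  simp
  ring

/-- Second difference bound for `log ‖·‖`: translating by `y` gains one power of decay. -/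
theorem abs_log_norm_sub_second_difference_le {E : Type*} [NormedAddCommGroup E]
    [InnerProductSpace ℝ E] {x₀ x y : E} (h₀ : x₀ ≠ 0) (hy : 4 * ‖y‖ ≤ ‖x₀‖)
    (hx : x ∈ Metric.ball x₀ (‖x₀‖ / 2)) :
    |(Real.log ‖x - y‖ - Real.log ‖x‖) - (Real.log ‖x₀ - y‖ - Real.log ‖x₀‖)|
      ≤ 8 * ‖y‖ / ‖x₀‖ ^ 2 * ‖x - x₀‖ := by
  have hpos : 0 < ‖x₀‖ := norm_pos_iff.2 h₀
  have key : ∀ w ∈ Metric.ball x₀ (‖x₀‖ / 2), ‖x₀‖ / 2 ≤ ‖w‖ ∧ ‖x₀‖ / 4 ≤ ‖w - y‖ := by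
    intro w hw
    rw [mem_ball_iff_norm'] at hw
    have h1 := norm_sub_norm_le x₀ w
    have h2 := norm_sub_norm_le w y
    constructor <;> linarith
  have hd : ∀ w ∈ Metric.ball x₀ (‖x₀‖ / 2),
      HasFDerivWithinAt (fun w => Real.log ‖w - y‖ - Real.log ‖w‖)
        (innerSL ℝ ((1 / ‖w - y‖) ^ 2 • (w - y)) - innerSL ℝ ((1 / ‖w‖) ^ 2 • w))
        (Metric.ball x₀ (‖x₀‖ / 2)) w := by
    intro w hw
    obtain ⟨h1, h2⟩ := key w hw
    have hw0 : w ≠ 0 := norm_pos_iff.1 (by linarith)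
    have hwy : w - y ≠ 0 := norm_pos_iff.1 (by linarith)
    have h3 := (hasFDerivAt_log_norm hwy).comp w ((hasFDerivAt_id w).sub_const y)
    exact (h3.sub (hasFDerivAt_log_norm hw0)).hasFDerivWithinAt
  have hb : ∀ w ∈ Metric.ball x₀ (‖x₀‖ / 2),
      ‖innerSL ℝ ((1 / ‖w - y‖) ^ 2 • (w - y)) - innerSL ℝ ((1 / ‖w‖) ^ 2 • w)‖
        ≤ 8 * ‖y‖ / ‖x₀‖ ^ 2 := by
    intro w hw
    obtain ⟨h1, h2⟩ := key w hw
    have hw0 : w ≠ 0 := norm_pos_iff.1 (by linarith)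
    have hwy : w - y ≠ 0 := norm_pos_iff.1 (by linarith)
    rw [← map_sub, innerSL_apply_norm, ← dist_eq_norm,
      dist_div_norm_sq_smul hwy hw0, dist_eq_norm, sub_sub_cancel_left, norm_neg,
      one_pow, one_div_mul_eq_div]
    have h3 : ‖x₀‖ ^ 2 / 8 ≤ ‖w - y‖ * ‖w‖ := by
      calc ‖x₀‖ ^ 2 / 8 = ‖x₀‖ / 4 * (‖x₀‖ / 2) := by ring
        _ ≤ _ := by gcongr
    calc ‖y‖ / (‖w - y‖ * ‖w‖) ≤ ‖y‖ / (‖x₀‖ ^ 2 / 8) := by gcongr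
      _ = _ := by field_simp
  exact (convex_ball x₀ (‖x₀‖ / 2)).norm_image_sub_le_of_norm_hasFDerivWithin_le hd hb
    (Metric.mem_ball_self (by positivity)) hx

theorem integrable_log_norm_sub_mul {E : Type*} [NormedAddCommGroup E] [MeasurableSpace E]
    [BorelSpace E] {μ : Measure E} [IsFiniteMeasureOnCompacts μ] {φ : E → ℝ}
    (hφ : Continuous φ) (hs : HasCompactSupport φ) {x : E} (hx : x ∉ tsupport φ) :
    Integrable (fun y => Real.log ‖x - y‖ * φ y) μ := by
  have hsub : Function.support (fun y => Real.log ‖x - y‖ * φ y) ⊆ tsupport φ :=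
    (Function.support_mul_subset_right _ _).trans (subset_tsupport φ)
  rw [← integrableOn_iff_integrable_of_support_subset hsub]
  refine ContinuousOn.integrableOn_compact hs ?_
  refine ContinuousOn.mul (ContinuousOn.log (by fun_prop) ?_) hφ.continuousOn
  intro y hy h
  rw [norm_eq_zero, sub_eq_zero] at h
  exact hx (h ▸ hy)

/-- The gradient of the logarithmic potential of a mean-zero smooth compactly supported
function decays like `1/‖x‖²` at infinity. -/
theorem stmt4 (φ : EuclideanSpace ℝ (Fin 2) → ℝ)
    (hφ : ContDiff ℝ (⊤ : ℕ∞) φ) (hs : HasCompactSupport φ)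
    (hmean : ∫ y, φ y = 0)
    (f : EuclideanSpace ℝ (Fin 2) → ℝ)
    (hf : ∀ x, f x = -(1 / (2 * Real.pi)) * ∫ y, Real.log ‖x - y‖ * φ y) :
    ∃ C > (0:ℝ), ∃ R₀ > (0:ℝ), ∀ x : EuclideanSpace ℝ (Fin 2), R₀ ≤ ‖x‖ →
      ‖gradient f x‖ ≤ C / ‖x‖ ^ 2 := by
  have hc : Continuous φ := hφ.continuous
  have hint : Integrable φ := hc.integrable_of_hasCompactSupport hs
  obtain ⟨R, hR, hsupp⟩ : ∃ R > 0, ∀ y ∈ tsupport φ, ‖y‖ ≤ R :=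
    hs.isBounded.exists_pos_norm_le
  set I := ∫ y, |φ y| with hI
  have hI0 : 0 ≤ I := integral_nonneg fun y => abs_nonneg _
  refine ⟨1 / (2 * Real.pi) * (8 * R * I) + 1, by positivity, 4 * R, by positivity, ?_⟩
  intro x₀ hx₀
  have hpos : 0 < ‖x₀‖ := by linarith
  have hgrad : ‖gradient f x₀‖ = ‖fderiv ℝ f x₀‖ := by
    simp [gradient]
  rw [hgrad]
  refine norm_fderiv_le_of_lip' ℝ (by positivity) ?_
  filter_upwards [Metric.ball_mem_nhds x₀ (half_pos hpos)] with x hx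
  have hx1 : ‖x₀‖ / 2 < ‖x‖ := by
    have h1 := norm_sub_norm_le x₀ x
    rw [mem_ball_iff_norm'] at hx
    linarith
  have hi := integrable_log_norm_sub_mul (μ := volume) hc hs
    (fun h => by linarith [hsupp x h] : x ∉ tsupport φ)
  have hi₀ := integrable_log_norm_sub_mul (μ := volume) hc hs
    (fun h => by linarith [hsupp x₀ h] : x₀ ∉ tsupport φ)
  have hsplit : (∫ y, Real.log ‖x - y‖ * φ y) - ∫ y, Real.log ‖x₀ - y‖ * φ y =
      ∫ y, ((Real.log ‖x - y‖ - Real.log ‖x‖) - (Real.log ‖x₀ - y‖ - Real.log ‖x₀‖)) * φ y := by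
    have h0 : ∫ y, (Real.log ‖x‖ - Real.log ‖x₀‖) * φ y = 0 := by
      rw [integral_const_mul, hmean, mul_zero]
    have h1 := integral_sub (hi.sub hi₀) (hint.const_mul (Real.log ‖x‖ - Real.log ‖x₀‖))
    rw [h0, sub_zero] at h1
    rw [← integral_sub hi hi₀]
    refine h1.symm.trans (integral_congr_ae (.of_forall fun y => ?_))
    simp only [Pi.sub_apply]
    ring
  have hbound : |(∫ y, Real.log ‖x - y‖ * φ y) - ∫ y, Real.log ‖x₀ - y‖ * φ y| ≤
      8 * R / ‖x₀‖ ^ 2 * ‖x - x₀‖ * I := by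
    rw [hsplit, hI, ← integral_const_mul, ← Real.norm_eq_abs]
    refine norm_integral_le_of_norm_le (hint.abs.const_mul _) (.of_forall fun y => ?_)
    rw [norm_mul, Real.norm_eq_abs, Real.norm_eq_abs]
    by_cases hy : y ∈ tsupport φ
    · have hyR := hsupp y hy
      refine mul_le_mul_of_nonneg_right ?_ (abs_nonneg _)
      refine (abs_log_norm_sub_second_difference_le (norm_pos_iff.1 hpos) (by linarith) hx).trans ?_
      gcongr
    · simp [image_eq_zero_of_notMem_tsupport hy]
  rw [hf, hf, ← mul_sub, norm_mul, norm_neg, Real.norm_eq_abs, Real.norm_eq_abs,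
    abs_of_pos (by positivity : 0 < 1 / (2 * Real.pi))]
  calc _ ≤ 1 / (2 * Real.pi) * (8 * R / ‖x₀‖ ^ 2 * ‖x - x₀‖ * I) := by gcongr
    _ = 1 / (2 * Real.pi) * (8 * R * I) / ‖x₀‖ ^ 2 * ‖x - x₀‖ := by ring
    _ ≤ _ := by
      gcongr
      linarith
end

section
/- For every smooth compactly supported function φ : ℝ² → ℝ with ∫_{ℝ²} φ = 0, the Dirichlet energy is nonnegative: G(φ,φ) = −(1/2π)∫_{ℝ²}∫_{ℝ²} log‖x−y‖ φ(x)φ(y) dx dy ≥ 0. -/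
open MeasureTheory

section Frullani

open Set Filter Topology

theorem abs_inv_mul_exp_sub_exp_le {a b s : ℝ} (hs : 0 < s) (hab : a ≤ b) :
    |s⁻¹ * (Real.exp (-(a * s)) - Real.exp (-(b * s)))| ≤ (b - a) * Real.exp (-a * s) := by
  have hle : Real.exp (-(b * s)) ≤ Real.exp (-(a * s)) :=
    Real.exp_le_exp.2 (by nlinarith)
  rw [abs_of_nonneg (mul_nonneg (inv_nonneg.2 hs.le) (sub_nonneg.2 hle)), inv_mul_le_iff₀ hs]
  have h := Real.add_one_le_exp (-((b - a) * s))
  have hmul : Real.exp (-(b * s)) = Real.exp (-a * s) * Real.exp (-((b - a) * s)) := by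
    rw [← Real.exp_add]; ring_nf
  rw [hmul, ← neg_mul]
  nlinarith [Real.exp_pos (-a * s)]

theorem integrableOn_inv_mul_exp_sub_exp {a b : ℝ} (ha : 0 < a) (hb : 0 < b) :
    IntegrableOn (fun s : ℝ ↦ s⁻¹ * (Real.exp (-(a * s)) - Real.exp (-(b * s)))) (Ioi 0) := by
  wlog hab : a ≤ b generalizing a b
  · refine (this hb ha (le_of_not_ge hab)).neg.congr (.of_forall fun s ↦ ?_)
    simp only [Pi.neg_apply]
    ring
  refine Integrable.mono' ((integrableOn_exp_mul_Ioi (neg_lt_zero.2 ha) 0).const_mul (b - a))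
    (by fun_prop) ?_
  filter_upwards [ae_restrict_mem measurableSet_Ioi] with s hs
  exact abs_inv_mul_exp_sub_exp_le hs hab

theorem integral_inv_mul_exp_sub_exp {a b : ℝ} (ha : 0 < a) (hb : 0 < b) :
    ∫ s in Ioi (0 : ℝ), s⁻¹ * (Real.exp (-(a * s)) - Real.exp (-(b * s))) =
      Real.log (b / a) := by
  have hcont : Continuous fun s : ℝ ↦ Real.exp (-s) := by fun_prop
  have h := Frullani.integral_Ioi_eq (f := fun s ↦ Real.exp (-s)) (L := 1) (R := 0)
    (hcont.continuousOn.locallyIntegrableOn measurableSet_Ioi) ha hb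
    (by simpa using (hcont.tendsto 0).mono_left nhdsWithin_le_nhds)
    Real.tendsto_exp_neg_atTop_nhds_zero (integrableOn_inv_mul_exp_sub_exp ha hb)
  simpa using h

theorem integral_abs_inv_mul_exp_sub_exp {a b : ℝ} (ha : 0 < a) (hb : 0 < b) :
    ∫ s in Ioi (0 : ℝ), |s⁻¹ * (Real.exp (-(a * s)) - Real.exp (-(b * s)))| =
      |Real.log (b / a)| := by
  wlog hab : a ≤ b generalizing a b
  · rw [← inv_div, Real.log_inv, abs_neg, ← this hb ha (le_of_not_ge hab)]
    refine integral_congr_ae (.of_forall fun s ↦ ?_)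
    simp only
    rw [← abs_neg]
    ring_nf
  rw [abs_of_nonneg (Real.log_nonneg ((one_le_div ha).2 hab)),
    ← integral_inv_mul_exp_sub_exp ha hb]
  refine setIntegral_congr_fun measurableSet_Ioi fun s (hs : 0 < s) ↦ ?_
  have hle : Real.exp (-(b * s)) ≤ Real.exp (-(a * s)) :=
    Real.exp_le_exp.2 (by nlinarith)
  exact abs_of_nonneg (mul_nonneg (inv_nonneg.2 hs.le) (sub_nonneg.2 hle))

end Frullani

section LogEnergy

variable {V : Type*} [NormedAddCommGroup V] [InnerProductSpace ℝ V] [FiniteDimensional ℝ V]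
  [MeasurableSpace V] [BorelSpace V]

theorem integrable_exp_neg_mul_sq_norm {b : ℝ} (hb : 0 < b) :
    Integrable fun v : V ↦ Real.exp (-b * ‖v‖ ^ 2) := by
  refine Integrable.of_integral_ne_zero ?_
  rw [GaussianFourier.integral_rexp_neg_mul_sq_norm hb]
  positivity

theorem integral_exp_neg_mul_exp_neg (b : ℝ) (x y : V) :
    ∫ z, Real.exp (-(2 * b) * ‖z - x‖ ^ 2) * Real.exp (-(2 * b) * ‖z - y‖ ^ 2) =
      Real.exp (-b * ‖x - y‖ ^ 2) * ∫ z : V, Real.exp (-(4 * b) * ‖z‖ ^ 2) := by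
  rw [← integral_sub_right_eq_self (fun z : V ↦ Real.exp (-(4 * b) * ‖z‖ ^ 2))
    ((1 / 2 : ℝ) • (x + y)), ← integral_const_mul]
  refine integral_congr_ae (.of_forall fun z ↦ ?_)
  simp only [← Real.exp_add]
  congr 1
  have h := parallelogram_law_with_norm ℝ (z - x) (z - y)
  have h1 : z - x + (z - y) = (2 : ℝ) • (z - (1 / 2 : ℝ) • (x + y)) := by module
  have h2 : z - x - (z - y) = -(x - y) := by abel
  rw [h1, h2, norm_smul, norm_neg, Real.norm_ofNat] at h
  linear_combination b * h

theorem integral_exp_neg_mul_sq_norm_sub_mul_nonneg {φ : V → ℝ} (hφ : Integrable φ)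
    {b : ℝ} (hb : 0 < b) :
    0 ≤ ∫ p : V × V, Real.exp (-b * ‖p.1 - p.2‖ ^ 2) * (φ p.1 * φ p.2) := by
  set c := ∫ z : V, Real.exp (-(4 * b) * ‖z‖ ^ 2) with hc_def
  have hc : 0 < c := by
    rw [hc_def, GaussianFourier.integral_rexp_neg_mul_sq_norm (by positivity)]
    positivity
  set g : V → ℝ := fun z ↦ Real.exp (-(2 * b) * ‖z‖ ^ 2) with hg
  have hgi : Integrable g := integrable_exp_neg_mul_sq_norm (by positivity)
  have hgc : Continuous g := by fun_prop
  have hint : Integrable (fun q : (V × V) × V ↦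
      (φ q.1.1 * φ q.1.2) * (g (q.2 - q.1.1) * g (q.2 - q.1.2)))
      ((volume.prod volume).prod volume) := by
    have h1 : Integrable (fun q : V × V ↦ φ q.1 * g (q.2 - q.1)) (volume.prod volume) :=
      (hφ.convolution_integrand (.mul ℝ ℝ) hgi).swap
    have h2 : Integrable (fun q : (V × V) × V ↦ φ q.1.1 * (φ q.1.2 * g (q.2 - q.1.2)))
        ((volume.prod volume).prod volume) :=
      (measurePreserving_prodAssoc volume volume volume).integrable_comp_of_integrable
        (hφ.mul_prod h1)
    refine (h2.bdd_mul (f := fun q ↦ g (q.2 - q.1.1)) (c := 1) (by fun_prop)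
      (.of_forall fun q ↦ ?_)).congr (.of_forall fun q ↦ ?_)
    · rw [hg, Real.norm_of_nonneg (Real.exp_nonneg _), Real.exp_le_one_iff]
      nlinarith [sq_nonneg ‖q.2 - q.1.1‖]
    · simp only
      ring
  have hswap := integral_integral_swap (f := fun (p : V × V) (z : V) ↦
      (φ p.1 * φ p.2) * (g (z - p.1) * g (z - p.2))) hint
  have hleft : ∀ p : V × V, ∫ z, (φ p.1 * φ p.2) * (g (z - p.1) * g (z - p.2)) =
      c * (Real.exp (-b * ‖p.1 - p.2‖ ^ 2) * (φ p.1 * φ p.2)) := fun p ↦ by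
    rw [integral_const_mul, integral_exp_neg_mul_exp_neg]
    ring
  have hright : ∀ z : V, ∫ p : V × V, (φ p.1 * φ p.2) * (g (z - p.1) * g (z - p.2)) =
      (∫ x, φ x * g (z - x)) ^ 2 := fun z ↦ by
    rw [sq, ← integral_prod_mul]
    refine integral_congr_ae (.of_forall fun p ↦ ?_)
    simp only
    ring
  rw [← Measure.volume_eq_prod] at hswap
  simp_rw [hleft, hright] at hswap
  rw [integral_const_mul] at hswap
  have : 0 ≤ c * ∫ p : V × V, Real.exp (-b * ‖p.1 - p.2‖ ^ 2) * (φ p.1 * φ p.2) :=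
    hswap ▸ integral_nonneg fun z ↦ sq_nonneg _
  exact nonneg_of_mul_nonneg_right this hc

theorem integrableOn_log_norm_ball [Nontrivial V] (r : ℝ) :
    IntegrableOn (fun x : V ↦ Real.log ‖x‖) (Metric.ball 0 r) := by
  rw [integrableOn_fun_norm_addHaar]
  have h : IntervalIntegrable (fun y : ℝ ↦ y ^ (Module.finrank ℝ V - 1) • Real.log y)
      volume 0 r := by
    refine intervalIntegral.intervalIntegrable_log'.continuousOn_smul ?_
    fun_prop
  exact h.1.mono_set Set.Ioo_subset_Ioc_self

theorem ae_fst_ne_snd [Nontrivial V] : ∀ᵐ p : V × V, p.1 ≠ p.2 := by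
  refine (Measure.ae_prod_iff_ae_ae (p := fun p : V × V ↦ p.1 ≠ p.2)
    (measurableSet_eq_fun measurable_fst measurable_snd).compl).2 (.of_forall fun x ↦ ?_)
  filter_upwards [compl_mem_ae_iff.2 (measure_singleton x)] with y hy
  exact Ne.symm hy

theorem integrable_log_norm_sub_mul_s6 [Nontrivial V] {φ : V → ℝ} (hφ : Continuous φ)
    (hs : HasCompactSupport φ) :
    Integrable fun p : V × V ↦ Real.log ‖p.1 - p.2‖ * (φ p.1 * φ p.2) := by
  obtain ⟨R, hR⟩ := hs.isCompact.isBounded.subset_ball 0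
  set g : V → ℝ := (Metric.ball 0 (R + R)).indicator fun x ↦ Real.log ‖x‖ with hg
  have hgi : Integrable g :=
    (integrable_indicator_iff measurableSet_ball).2 (integrableOn_log_norm_ball _)
  have h1 : Integrable fun p : V × V ↦ φ p.2 * g (p.1 - p.2) :=
    (hφ.integrable_of_hasCompactSupport hs).convolution_integrand (.mul ℝ ℝ) hgi
  obtain ⟨C, hC⟩ := hφ.bounded_above_of_compact_support hs
  have h2 := h1.bdd_mul (f := fun p : V × V ↦ φ p.1) (c := C) (by fun_prop)
    (.of_forall fun p ↦ hC p.1)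
  refine h2.congr (.of_forall fun p ↦ ?_)
  simp only
  by_cases hx : φ p.1 = 0
  · simp [hx]
  by_cases hy : φ p.2 = 0
  · simp [hy]
  have hx' := hR (subset_tsupport φ hx)
  have hy' := hR (subset_tsupport φ hy)
  rw [mem_ball_zero_iff] at hx' hy'
  have hmem : p.1 - p.2 ∈ Metric.ball (0 : V) (R + R) :=
    mem_ball_zero_iff.2 ((norm_sub_le _ _).trans_lt (add_lt_add hx' hy'))
  rw [hg, Set.indicator_of_mem hmem]
  ring

theorem integral_log_norm_sub_mul_nonpos [Nontrivial V] {φ : V → ℝ} (hφ : Continuous φ)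
    (hs : HasCompactSupport φ) (hmean : ∫ y, φ y = 0) :
    ∫ p : V × V, Real.log ‖p.1 - p.2‖ * (φ p.1 * φ p.2) ≤ 0 := by
  have hφi : Integrable φ := hφ.integrable_of_hasCompactSupport hs
  have hff : Integrable fun p : V × V ↦ φ p.1 * φ p.2 := hφi.mul_prod hφi
  set F : V × V → ℝ → ℝ := fun p s ↦
    s⁻¹ * (Real.exp (-(1 * s)) - Real.exp (-(‖p.1 - p.2‖ ^ 2 * s))) * (φ p.1 * φ p.2) with hF
  have hpos : ∀ p : V × V, p.1 ≠ p.2 → 0 < ‖p.1 - p.2‖ ^ 2 := fun p hp ↦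
    pow_pos (norm_pos_iff.2 (sub_ne_zero.2 hp)) 2
  have hlog : ∀ p : V × V, Real.log (‖p.1 - p.2‖ ^ 2 / 1) = 2 * Real.log ‖p.1 - p.2‖ :=
    fun p ↦ by simp
  have hint : Integrable (Function.uncurry F)
      ((volume : Measure (V × V)).prod (volume.restrict (Set.Ioi (0 : ℝ)))) := by
    refine (integrable_prod_iff ?_).2 ⟨?_, ?_⟩
    · refine Measurable.aestronglyMeasurable ?_
      simp only [hF, Function.uncurry_def]
      have := hφ.measurable
      fun_prop
    · filter_upwards [ae_fst_ne_snd] with p hp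
      exact (integrableOn_inv_mul_exp_sub_exp one_pos (hpos p hp)).mul_const
        (φ p.1 * φ p.2)
    · refine ((integrable_log_norm_sub_mul_s6 hφ hs).norm.const_mul 2).congr ?_
      filter_upwards [ae_fst_ne_snd] with p hp
      simp only [hF, Function.uncurry_apply_pair, norm_mul (_ * (_ - _)), Real.norm_eq_abs]
      rw [integral_mul_const, integral_abs_inv_mul_exp_sub_exp one_pos (hpos p hp), hlog,
        abs_mul 2, abs_two, abs_mul, mul_assoc]
  have hswap := integral_integral_swap hint
  have hleft : ∫ p, ∫ s in Set.Ioi (0 : ℝ), F p s =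
      2 * ∫ p : V × V, Real.log ‖p.1 - p.2‖ * (φ p.1 * φ p.2) := by
    rw [← integral_const_mul]
    refine integral_congr_ae ?_
    filter_upwards [ae_fst_ne_snd] with p hp
    rw [hF, integral_mul_const, integral_inv_mul_exp_sub_exp one_pos (hpos p hp), hlog]
    ring
  have hright : ∫ s in Set.Ioi (0 : ℝ), ∫ p, F p s ≤ 0 := by
    refine setIntegral_nonpos measurableSet_Ioi fun s (hs0 : 0 < s) ↦ ?_
    have hgi : Integrable fun p : V × V ↦
        Real.exp (-s * ‖p.1 - p.2‖ ^ 2) * (φ p.1 * φ p.2) := by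
      refine hff.bdd_mul (c := 1) (by fun_prop) (.of_forall fun p ↦ ?_)
      rw [Real.norm_of_nonneg (Real.exp_nonneg _), Real.exp_le_one_iff]
      nlinarith [sq_nonneg ‖p.1 - p.2‖]
    have hzero : ∫ p : V × V, φ p.1 * φ p.2 = 0 := by
      rw [Measure.volume_eq_prod, integral_prod_mul, hmean, zero_mul]
    have heq : ∫ p, F p s =
        -(s⁻¹ * ∫ p : V × V, Real.exp (-s * ‖p.1 - p.2‖ ^ 2) * (φ p.1 * φ p.2)) := by
      calc ∫ p, F p s = ∫ p : V × V, (s⁻¹ * Real.exp (-s) * (φ p.1 * φ p.2) -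
            s⁻¹ * (Real.exp (-s * ‖p.1 - p.2‖ ^ 2) * (φ p.1 * φ p.2))) := by
            refine integral_congr_ae (.of_forall fun p ↦ ?_)
            simp only [hF, one_mul, neg_mul, mul_comm s]
            ring
        _ = _ := by
          rw [integral_sub (hff.const_mul _) (hgi.const_mul _), integral_const_mul,
            integral_const_mul, hzero]
          ring
    rw [heq]
    exact neg_nonpos.2 (mul_nonneg (inv_nonneg.2 hs0.le)
      (integral_exp_neg_mul_sq_norm_sub_mul_nonneg hφi hs0))
  linarith

end LogEnergy

/-- Nonnegativity of the Dirichlet energy of a mean-zero smooth compactly supported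
function. -/
theorem stmt6 (φ : EuclideanSpace ℝ (Fin 2) → ℝ)
    (hφ : ContDiff ℝ (⊤ : ℕ∞) φ) (hs : HasCompactSupport φ)
    (hmean : ∫ y, φ y = 0) :
    0 ≤ -(1 / (2 * Real.pi)) * ∫ x, ∫ y, Real.log ‖x - y‖ * φ x * φ y := by
  have h := integral_log_norm_sub_mul_nonpos hφ.continuous hs hmean
  rw [Measure.volume_eq_prod, integral_prod _ (integrable_log_norm_sub_mul_s6 hφ.continuous hs)] at h
  simp only [← mul_assoc] at h
  exact mul_nonneg_of_nonpos_of_nonpos (neg_nonpos.2 (by positivity)) h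
end

section
/- Let k be a positive integer and let x₁, …, x_k be pairwise distinct elements of a field F of characteristic zero (e.g. ℝ or ℂ). Let M be the k × k matrix with entries m_{ii} = 0 and m_{ij} = 1/(x_i − x_j) for i ≠ j. If k is odd then det M = 0, and if k is even then det M = Σ_τ ∏_{r=1}^{k/2} 1/(x_{a_r} − x_{b_r})², where the sum runs over all (k−1)!! partitions τ = {{a₁,b₁}, …, {a_{k/2},b_{k/2}}} of {1,…,k} into unordered pairs. -/
open Finset

/-- The involutions of `α` whose set of non-fixed points is exactly `S`,
that is, the pairings of `S`. -/
def pairings {α : Type*} [Fintype α] [DecidableEq α] (S : Finset α) : Finset (Equiv.Perm α) :=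
  Finset.univ.filter fun σ => (∀ i, σ (σ i) = i) ∧ ∀ i, σ i ≠ i ↔ i ∈ S

theorem mem_pairings {α : Type*} [Fintype α] [DecidableEq α] {S : Finset α}
    {σ : Equiv.Perm α} :
    σ ∈ pairings S ↔ (∀ i, σ (σ i) = i) ∧ ∀ i, σ i ≠ i ↔ i ∈ S := by
  simp [pairings]

/-- Splitting the pairings of `S` according to the partner of the least element of `S`. -/
theorem sum_pairings_eq_sum_erase {α R : Type*} [Fintype α] [LinearOrder α] [CommSemiring R]
    (w : α → α → R) (S : Finset α) (a : α) (ha : a ∈ S) (hmin : ∀ b ∈ S, a ≤ b) :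
    ∑ σ ∈ pairings S, ∏ i ∈ Finset.univ.filter (fun i => i < σ i), w i (σ i) =
      ∑ b ∈ S.erase a, w a b * ∑ τ ∈ pairings ((S.erase a).erase b),
        ∏ i ∈ Finset.univ.filter (fun i => i < τ i), w i (τ i) := by
  simp_rw [Finset.mul_sum]
  rw [Finset.sum_sigma']
  symm
  refine Finset.sum_bij' (fun p _ => Equiv.swap a p.1 * p.2)
    (fun σ _ => ⟨σ a, Equiv.swap a (σ a) * σ⟩) ?_ ?_ ?_ ?_ ?_
  · rintro ⟨b, τ⟩ h
    simp only [Finset.mem_sigma, mem_pairings, Finset.mem_erase, Equiv.Perm.mul_apply,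
      Equiv.swap_apply_def] at h ⊢
    grind
  · intro σ h
    simp only [Finset.mem_sigma, mem_pairings, Finset.mem_erase, Equiv.Perm.mul_apply,
      Equiv.swap_apply_def] at h ⊢
    grind
  · rintro ⟨b, τ⟩ h
    simp only [Finset.mem_sigma, mem_pairings, Finset.mem_erase] at h
    have hτ : τ a = a := by grind
    simp [hτ, ← mul_assoc]
  · intro σ h
    simp [← mul_assoc]
  · rintro ⟨b, τ⟩ h
    simp only [Finset.mem_sigma, mem_pairings, Finset.mem_erase] at h
    obtain ⟨⟨hba, hbS⟩, hinv, hsupp⟩ := h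
    have hτa : τ a = a := by grind
    have hτb : τ b = b := by grind
    have hab : a < b := lt_of_le_of_ne (hmin b hbS) hba.symm
    have hval : ∀ i, i ≠ a → i ≠ b → (Equiv.swap a b * τ) i = τ i := by
      intro i hia hib
      simp only [Equiv.Perm.mul_apply, Equiv.swap_apply_def]
      grind
    have hvala : (Equiv.swap a b * τ) a = b := by simp [hτa]
    have hfilter : Finset.univ.filter (fun i => i < (Equiv.swap a b * τ) i) =
        insert a (Finset.univ.filter fun i => i < τ i) := by
      ext i
      simp only [Finset.mem_filter, Finset.mem_univ, true_and, Finset.mem_insert]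
      by_cases hia : i = a
      · simp [hia, hτa, hab]
      by_cases hib : i = b
      · simp [hib, hτb, hba, hab.le]
      · simp [hval i hia hib, hia]
    rw [hfilter, Finset.prod_insert (by simp [hτa]), hvala]
    congr 1
    refine Finset.prod_congr rfl fun i hi => ?_
    rw [Finset.mem_filter] at hi
    rw [hval i (by grind) (by grind)]

/-- Expansion of a determinant with vanishing corner entry along its first row and column. -/
theorem Matrix.det_succ_of_apply_zero_zero {R : Type*} [CommRing R] {n : ℕ}
    (M : Matrix (Fin (n + 2)) (Fin (n + 2)) R) (h : M 0 0 = 0) :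
    M.det = -∑ i, ∑ j, M 0 i.succ * M j.succ 0 *
      (M.submatrix Fin.succ Fin.succ).adjugate i j := by
  rw [Matrix.det_succ_row_zero, Fin.sum_univ_succ, h]
  simp only [mul_zero, zero_mul, zero_add]
  rw [← Finset.sum_neg_distrib]
  refine Finset.sum_congr rfl fun i _ => ?_
  rw [Matrix.det_succ_column_zero, Finset.mul_sum, ← Finset.sum_neg_distrib]
  refine Finset.sum_congr rfl fun j _ => ?_
  rw [Matrix.adjugate_fin_succ_eq_det_submatrix, Matrix.submatrix_submatrix,
    Matrix.submatrix_submatrix]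
  have hcomp : i.succ.succAbove ∘ Fin.succ = Fin.succ ∘ i.succAbove := by
    ext l
    simp
  simp only [Matrix.submatrix_apply, hcomp, Fin.succ_succAbove_zero, Fin.val_succ]
  ring

/-- The matrix with entries `1 / (x i - x j)`; the diagonal vanishes since `0⁻¹ = 0`. -/
def invSubMatrix {ι F : Type*} [Field F] (x : ι → F) : Matrix ι ι F :=
  Matrix.of fun i j => (x i - x j)⁻¹

theorem invSubMatrix_apply {ι F : Type*} [Field F] (x : ι → F) (i j : ι) :
    invSubMatrix x i j = (x i - x j)⁻¹ := rfl

theorem invSubMatrix_transpose {ι F : Type*} [Field F] (x : ι → F) :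
    (invSubMatrix x).transpose = -invSubMatrix x := by
  ext i j
  simp [invSubMatrix_apply, ← inv_neg]

/-- The off-diagonal part of the quadratic form `u ↦ u ⬝ adj(M) u` at `u i = 1 / (a - x i)`
vanishes for `M i j = 1 / (x i - x j)`. -/
theorem sum_mul_adjugate_invSubMatrix {ι F : Type*} [Field F] [Fintype ι] [DecidableEq ι]
    (x : ι → F) (hx : Function.Injective x) (a : F) (ha : ∀ i, a ≠ x i) :
    ∑ i, ∑ j, (a - x i)⁻¹ * (a - x j)⁻¹ * (invSubMatrix x).adjugate i j =
      ∑ i, ((a - x i) ^ 2)⁻¹ * (invSubMatrix x).adjugate i i := by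
  set M := invSubMatrix x with hM
  set u : ι → F := fun i => (a - x i)⁻¹ with hu
  have hsplit : ∀ i j, u i * u j * M.adjugate i j =
      (if i = j then u i ^ 2 * M.adjugate i i else 0) +
        (u j * (M j i * M.adjugate i j) - u i * (M j i * M.adjugate i j)) := by
    intro i j
    split_ifs with hij
    · subst hij
      ring
    · have h1 : a - x i ≠ 0 := sub_ne_zero.2 (ha i)
      have h2 : a - x j ≠ 0 := sub_ne_zero.2 (ha j)
      have h3 : x j - x i ≠ 0 := sub_ne_zero.2 fun h => hij (hx h.symm)
      have h4 : u i * u j = M j i * (u j - u i) := by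
        simp only [hu, hM, invSubMatrix_apply]
        field_simp
        ring
      rw [h4]
      ring
  have hcol : ∀ j, ∑ i, u j * (M j i * M.adjugate i j) = u j * M.det := by
    intro j
    rw [← Finset.mul_sum, ← Matrix.mul_apply, Matrix.mul_adjugate]
    simp
  have hrow : ∀ i, ∑ j, u i * (M j i * M.adjugate i j) = u i * M.det := by
    intro i
    simp_rw [mul_comm (M _ i)]
    rw [← Finset.mul_sum, ← Matrix.mul_apply, Matrix.adjugate_mul]
    simp
  change ∑ i, ∑ j, u i * u j * M.adjugate i j = _
  simp_rw [hsplit, Finset.sum_add_distrib, Finset.sum_sub_distrib, hrow]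
  rw [Finset.sum_comm (f := fun i j => u j * (M j i * M.adjugate i j))]
  simp_rw [hcol]
  simp [hu, inv_pow]

/-- Recursion for `det (1 / (x i - x j))` obtained by removing the first point and
one further point. -/
theorem det_invSubMatrix_succ {F : Type*} [Field F] {n : ℕ} (x : Fin (n + 2) → F)
    (hx : Function.Injective x) :
    (invSubMatrix x).det = ∑ j : Fin (n + 1), ((x 0 - x j.succ) ^ 2)⁻¹ *
      (invSubMatrix fun i => x (j.succAbove i).succ).det := by
  rw [Matrix.det_succ_of_apply_zero_zero _ (by simp [invSubMatrix_apply])]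
  have hsub : (invSubMatrix x).submatrix Fin.succ Fin.succ = invSubMatrix (x ∘ Fin.succ) := rfl
  have hq := sum_mul_adjugate_invSubMatrix (x ∘ Fin.succ)
    (hx.comp (Fin.succ_injective _)) (x 0) fun i h => (Fin.succ_ne_zero i) (hx h).symm
  have hneg : ∀ j : Fin (n + 1), (x j.succ - x 0)⁻¹ = -(x 0 - x j.succ)⁻¹ := fun j => by
    rw [← inv_neg, neg_sub]
  simp only [Function.comp_apply] at hq
  simp only [hsub, invSubMatrix_apply, hneg, mul_neg, neg_mul, Finset.sum_neg_distrib, neg_neg, hq]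
  refine Finset.sum_congr rfl fun j _ => ?_
  rw [Matrix.adjugate_fin_succ_eq_det_submatrix, Even.neg_one_pow ⟨_, rfl⟩, one_mul]
  rfl

theorem det_invSubMatrix_eq_sum_pairings {α F : Type*} [Fintype α] [LinearOrder α] [Field F]
    (x : α → F) (hx : Function.Injective x) :
    ∀ (n : ℕ) (f : Fin n → α), StrictMono f →
      (invSubMatrix (x ∘ f)).det = ∑ σ ∈ pairings (Finset.univ.image f),
        ∏ i ∈ Finset.univ.filter (fun i => i < σ i), ((x i - x (σ i)) ^ 2)⁻¹
  | 0, f, _ => by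
    have h : pairings (Finset.univ.image f) = {1} := by
      ext σ
      simp only [mem_pairings, Finset.mem_singleton, Equiv.Perm.ext_iff]
      simp +contextual
    rw [h]
    simp
  | 1, f, _ => by
    have h : pairings (Finset.univ.image f) = ∅ := by
      refine Finset.eq_empty_of_forall_notMem fun σ hσ => ?_
      simp only [mem_pairings, Finset.univ_unique, Finset.image_singleton,
        Finset.mem_singleton] at hσ
      have hne := (hσ.2 (f default)).2 rfl
      exact hne ((hσ.2 _).1 fun h => hne (σ.injective h))
    rw [h]
    simp [invSubMatrix_apply]
  | n + 2, f, hf => by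
    rw [det_invSubMatrix_succ _ (hx.comp hf.injective),
      sum_pairings_eq_sum_erase (fun a b => ((x a - x b) ^ 2)⁻¹) _ (f 0)
        (Finset.mem_image_of_mem f (Finset.mem_univ 0))
        (by simp [hf.le_iff_le])]
    have herase : (Finset.univ.image f).erase (f 0) =
        Finset.univ.image fun j : Fin (n + 1) => f j.succ := by
      ext b
      simp only [Finset.mem_erase, Finset.mem_image, Finset.mem_univ, true_and,
        Fin.exists_fin_succ (P := fun i => f i = b)]
      have := fun j : Fin (n + 1) => (hf (Fin.succ_pos j)).ne'
      grind
    have hinj : Function.Injective fun j : Fin (n + 1) => f j.succ :=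
      hf.injective.comp (Fin.succ_injective _)
    rw [herase, Finset.sum_image fun _ _ _ _ h => hinj h]
    refine Finset.sum_congr rfl fun j _ => ?_
    have hmono : StrictMono fun i : Fin n => f (j.succAbove i).succ :=
      hf.comp (Fin.strictMono_succ.comp (Fin.strictMono_succAbove j))
    have herase' : (Finset.univ.image fun j : Fin (n + 1) => f j.succ).erase (f j.succ) =
        Finset.univ.image fun i : Fin n => f (j.succAbove i).succ := by
      rw [← Finset.image_erase hinj, ← Finset.compl_singleton, ← Fin.image_succAbove_univ,
        Finset.image_image]
      rfl
    rw [herase', ← det_invSubMatrix_eq_sum_pairings x hx n _ hmono]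
    rfl

/-- Kenyon's determinant identity: for the antisymmetric matrix `M` with entries
`m_{ij} = 1/(x_i − x_j)` off the diagonal, `det M = 0` for odd `k`, and for even `k`
`det M` is the sum over all pairings of `{1,…,k}` (encoded as fixed-point-free
involutions `σ`) of the product over the pairs `{i, σ i}` of `1/(x_i − x_{σ i})²`. -/
theorem stmt8 {F : Type*} [Field F] [CharZero F] (k : ℕ) (hk : 0 < k)
    (x : Fin k → F) (hx : Function.Injective x)
    (M : Matrix (Fin k) (Fin k) F)
    (hM : ∀ i j, M i j = if i = j then 0 else (x i - x j)⁻¹) :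
    (Odd k → M.det = 0) ∧
    (Even k → M.det =
      ∑ σ ∈ Finset.univ.filter
          (fun σ : Equiv.Perm (Fin k) => σ * σ = 1 ∧ ∀ i, σ i ≠ i),
        ∏ i ∈ Finset.univ.filter (fun i => i < σ i), ((x i - x (σ i)) ^ 2)⁻¹) := by
  obtain rfl : M = invSubMatrix x := by
    ext i j
    rw [hM, invSubMatrix_apply]
    split_ifs with h <;> simp [h]
  refine ⟨fun hodd => ?_, fun _ => ?_⟩
  · have h := Matrix.det_transpose (invSubMatrix x)
    rw [invSubMatrix_transpose, Matrix.det_neg, Fintype.card_fin, hodd.neg_one_pow,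
      neg_one_mul] at h
    exact self_eq_neg.1 h.symm
  · have h := det_invSubMatrix_eq_sum_pairings x hx k id strictMono_id
    rw [Function.comp_id] at h
    rw [h]
    refine Finset.sum_congr ?_ fun _ _ => rfl
    ext σ
    simp [mem_pairings, Equiv.Perm.ext_iff]
end
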